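/- Let μ > 0 and for each integer N ≥ 1 set ℏ = ℏ_N := μ/N. Then there exist positive constants C and c such that for all N ≥ 1 and all y ∈ ℝ, | ℏ^{2/3} K_N(√(2μ) − ℏ^{2/3} y, √(2μ) + ℏ^{2/3} y) | ≤ C e^{−c |y|^{3/2}}. -/

import Mathlib

open MeasureTheory Filter

/-- Physicists' Hermite polynomial `h_k(y) = (-1)^k e^{y^2} (d/dy)^k e^{-y^2}`. -/
noncomputable def hermiteH (k : ℕ) (y : ℝ) : ℝ :=
  (-1)^k * Real.exp (y^2) * iteratedDeriv k (fun t => Real.exp (-t^2)) y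

/-- Hermite function `ψ_k^ℏ`. -/
noncomputable def psiH (hbar : ℝ) (k : ℕ) (x : ℝ) : ℝ :=
  (Real.sqrt (Real.sqrt Real.pi * 2^k * (Nat.factorial k) * Real.sqrt hbar))⁻¹ *
    Real.exp (-x^2 / (2*hbar)) * hermiteH k (x / Real.sqrt hbar)

/-- Kernel of the spectral projection `P_{<N}`. -/
noncomputable def KerK (hbar : ℝ) (N : ℕ) (u v : ℝ) : ℝ :=
  ∑ k ∈ Finset.range N, psiH hbar k u * psiH hbar k v

/-- Kernel of the Zeno Hamiltonian `H_N = P_{<N} p̂ P_{<N}`. -/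
noncomputable def KerQ (hbar : ℝ) (N : ℕ) (u v : ℝ) : ℂ :=
  Complex.I * (Real.sqrt (hbar/2) : ℂ) *
    ∑ j ∈ Finset.range (N-1), ((Real.sqrt ((j:ℝ)+1) : ℝ) : ℂ) *
      ((psiH hbar (j+1) u * psiH hbar j v - psiH hbar j u * psiH hbar (j+1) v : ℝ) : ℂ)

/-- Weyl symbol of `P_{<N}`. -/
noncomputable def sigmaP (hbar : ℝ) (N : ℕ) (x p : ℝ) : ℂ :=
  ∫ y : ℝ, ((hbar * KerK hbar N (x - hbar*y/2) (x + hbar*y/2) : ℝ) : ℂ) *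
    Complex.exp (Complex.I * (p:ℂ) * (y:ℂ))

/-- Weyl symbol of `H_N`. -/
noncomputable def sigmaH (hbar : ℝ) (N : ℕ) (x p : ℝ) : ℂ :=
  ∫ y : ℝ, (hbar : ℂ) * KerQ hbar N (x - hbar*y/2) (x + hbar*y/2) *
    Complex.exp (Complex.I * (p:ℂ) * (y:ℂ))


/-! ### Hermite recurrence -/

lemma gauss_contDiff : ContDiff ℝ (⊤ : ℕ∞) (fun t : ℝ => Real.exp (-t^2)) := by fun_prop

lemma gauss_iter_hasDerivAt (n : ℕ) (t : ℝ) :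
    HasDerivAt (iteratedDeriv n (fun t : ℝ => Real.exp (-t^2)))
      (iteratedDeriv (n+1) (fun t : ℝ => Real.exp (-t^2)) t) t := by
  rw [iteratedDeriv_succ]
  apply DifferentiableAt.hasDerivAt
  have := gauss_contDiff.differentiable_iteratedDeriv n
    (by exact_mod_cast WithTop.coe_lt_top n)
  exact this t

lemma gauss_iter_one (t : ℝ) : iteratedDeriv 1 (fun t : ℝ => Real.exp (-t^2)) t
    = -2 * t * Real.exp (-t^2) := by
  rw [iteratedDeriv_one]
  have h : HasDerivAt (fun t : ℝ => Real.exp (-t^2)) (Real.exp (-t^2) * (-(2 * t))) t := by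
    have := ((hasDerivAt_pow 2 t).neg).exp
    simpa using this
  rw [h.deriv]; ring

lemma gauss_iter_rec (n : ℕ) : ∀ t : ℝ,
    iteratedDeriv (n+2) (fun t : ℝ => Real.exp (-t^2)) t =
      -2 * t * iteratedDeriv (n+1) (fun t : ℝ => Real.exp (-t^2)) t
      - 2 * (n+1) * iteratedDeriv n (fun t : ℝ => Real.exp (-t^2)) t := by
  induction n with
  | zero =>
    intro t
    have h1 := gauss_iter_hasDerivAt 1 t
    have h2 : HasDerivAt (iteratedDeriv 1 (fun t : ℝ => Real.exp (-t^2)))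
        (-2 * Real.exp (-t^2) +
          (-2 * t) * iteratedDeriv 1 (fun t : ℝ => Real.exp (-t^2)) t) t := by
      have e : iteratedDeriv 1 (fun t : ℝ => Real.exp (-t^2)) =
          fun t => (-2 * t) * Real.exp (-t^2) := by
        funext s; exact gauss_iter_one s
      have h3 := gauss_iter_hasDerivAt 0 t
      rw [iteratedDeriv_zero] at h3
      have h4 := ((hasDerivAt_id t).const_mul (-2)).mul h3
      rw [e]
      rw [← e]
      refine (h4.congr_of_eventuallyEq ?_).congr_deriv ?_
      · exact Filter.Eventually.of_forall (fun s => by rw [gauss_iter_one s]; simp)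
      · simp
    have := h1.unique h2
    rw [show 0 + 2 = 1 + 1 from rfl, this]
    simp only [iteratedDeriv_zero, Nat.cast_zero, zero_add]
    ring
  | succ n ih =>
    intro t
    have h1 := gauss_iter_hasDerivAt (n+2) t
    have h2 := ((((hasDerivAt_id t).const_mul (-2)).mul (gauss_iter_hasDerivAt (n+1) t)).sub
      ((gauss_iter_hasDerivAt n t).const_mul (2 * ((n:ℝ)+1))))
    have h3 := h2.congr_of_eventuallyEq
      (f₁ := iteratedDeriv (n+2) (fun t : ℝ => Real.exp (-t^2)))
      (Filter.Eventually.of_forall (fun s => by rw [ih s]; simp))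
    have := h1.unique h3
    rw [show n + 1 + 2 = n + 2 + 1 from rfl, this]
    simp only [id]
    push_cast
    ring

lemma hermiteH_zero (y : ℝ) : hermiteH 0 y = 1 := by
  simp [hermiteH, ← Real.exp_add]

lemma hermiteH_one (y : ℝ) : hermiteH 1 y = 2 * y := by
  have : Real.exp (y^2) * Real.exp (-y^2) = 1 := by rw [← Real.exp_add]; simp
  unfold hermiteH
  rw [gauss_iter_one]
  linear_combination (2*y) * this

lemma hermiteH_rec (n : ℕ) (y : ℝ) :
    hermiteH (n+2) y = 2 * y * hermiteH (n+1) y - 2 * (n+1) * hermiteH n y := by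
  unfold hermiteH
  rw [gauss_iter_rec]
  ring

/-! ### Normalised squares and summability -/

/-- `h_k² / (2^k k!)`. -/
noncomputable def qH (y : ℝ) (k : ℕ) : ℝ := hermiteH k y ^ 2 / (2^k * (Nat.factorial k))

lemma qH_nonneg (y : ℝ) (k : ℕ) : 0 ≤ qH y k := by unfold qH; positivity

lemma qH_rec_le (y ρ : ℝ) (h0 : 0 < ρ) (h1 : ρ < 1) (k : ℕ) :
    qH y (k+2) ≤ (1/(1-ρ)) * (2*y^2/(k+2)) * qH y (k+1) + (1/ρ) * qH y k := by
  have hr : (0:ℝ) < 1 - ρ := by linarith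
  have key : hermiteH (k+2) y ^ 2 ≤ (1/(1-ρ)) * (4*y^2) * hermiteH (k+1) y ^2
      + (1/ρ) * (4 * (k+1)^2) * hermiteH k y ^2 := by
    rw [hermiteH_rec]
    generalize hermiteH (k+1) y = A
    generalize hermiteH k y = B
    have : (1/(1-ρ)) * (4*y^2) * A ^2 + (1/ρ) * (4 * (k+1)^2) * B ^2
        - (2 * y * A - 2 * (k+1) * B)^2 =
        (ρ * (2*y*A) + (1-ρ) * (2*(k+1)*B))^2 / (ρ*(1-ρ)) := by
      field_simp
      ring
    have h2 : 0 ≤ (ρ * (2*y*A) + (1-ρ) * (2*(k+1)*B))^2 / (ρ*(1-ρ)) := by positivity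
    linarith
  have hk : (0:ℝ) < k + 1 := by positivity
  have hk2 : (0:ℝ) < k + 2 := by positivity
  have hf : (0:ℝ) < (Nat.factorial k) := by exact_mod_cast Nat.factorial_pos k
  unfold qH
  rw [show k + 2 = (k+1)+1 from rfl, Nat.factorial_succ (k+1), Nat.factorial_succ k]
  push_cast
  rw [show (k:ℝ)+1+1 = k+2 by ring]
  calc _ ≤ ((1/(1-ρ)) * (4*y^2) * hermiteH (k+1) y ^2
      + (1/ρ) * (4 * (k+1)^2) * hermiteH k y ^2) /
        (2^(k+1+1) * ((k+2) * ((k+1) * (Nat.factorial k)))) := by gcongr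
    _ = (1/(1-ρ)) * (2*y^2/(k+2)) * (hermiteH (k+1) y ^2/(2^(k+1) * ((k+1) * Nat.factorial k)))
       + (1/ρ) * (hermiteH k y ^2/(2^k * Nat.factorial k)) * ((k+1)/(k+2)) := by
        field_simp
        ring
    _ ≤ _ := by
        apply add_le_add le_rfl
        apply mul_le_of_le_one_right (by positivity)
        rw [div_le_one hk2]; linarith

lemma qH_bound (y ρ : ℝ) (h0 : 0 < ρ) (h1 : ρ < 1) : ∃ C, ∀ k, ρ^k * qH y k ≤ C := by
  have hr : (0:ℝ) < 1 - ρ := by linarith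
  obtain ⟨K, hK⟩ := exists_nat_gt (2*y^2/(1-ρ)^2)
  -- bound up to K+1
  let M : ℝ := ∑ k ∈ Finset.range (K+2), ρ^k * qH y k
  have hM : ∀ k < K+2, ρ^k * qH y k ≤ M := fun k hk =>
    Finset.single_le_sum (f := fun k => ρ^k * qH y k)
      (fun i _ => mul_nonneg (by positivity) (qH_nonneg y i)) (Finset.mem_range.2 hk)
  have hM0 : 0 ≤ M := Finset.sum_nonneg
      (fun i _ => mul_nonneg (by positivity) (qH_nonneg y i))
  refine ⟨M, ?_⟩
  have step : ∀ n, ρ^(K+n) * qH y (K+n) ≤ M ∧ ρ^(K+n+1) * qH y (K+n+1) ≤ M := by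
    intro n
    induction n with
    | zero => exact ⟨hM _ (by omega), hM _ (by omega)⟩
    | succ n ih =>
      refine ⟨ih.2, ?_⟩
      have := qH_rec_le y ρ h0 h1 (K+n)
      have hc : (1/(1-ρ)) * (2*y^2/((K+n:ℕ)+2)) ≤ 1 - ρ := by
        have : (K:ℝ) ≤ ((K+n:ℕ):ℝ) + 2 := by push_cast; linarith [(Nat.cast_nonneg n : (0:ℝ) ≤ n)]
        have h3 : 2*y^2/(1-ρ)^2 < ((K+n:ℕ):ℝ)+2 := by linarith
        have h4 : (0:ℝ) < ((K+n:ℕ):ℝ)+2 := by positivity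
        rw [div_lt_iff₀ (by positivity)] at h3
        rw [div_mul_div_comm, div_le_iff₀ (by positivity)]
        nlinarith
      have hq := qH_nonneg y (K+n+1)
      calc ρ^(K+(n+1)+1) * qH y (K+(n+1)+1)
          = ρ^(K+n+2) * qH y (K+n+2) := rfl
        _ ≤ ρ^(K+n+2) * ((1 - ρ) * qH y (K+n+1) + (1/ρ) * qH y (K+n)) := by
            gcongr
            refine this.trans ?_
            gcongr
        _ = ρ * ((1-ρ) * (ρ^(K+n+1) * qH y (K+n+1))) + ρ * (ρ^(K+n) * qH y (K+n)) := by
            field_simp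
            ring
        _ ≤ ρ * ((1-ρ) * M) + ρ * M := by
            gcongr
            · exact ih.2
            · exact ih.1
        _ ≤ M := by nlinarith [mul_nonneg hM0 (sq_nonneg (1-ρ))]
  intro k
  by_cases hk : k < K+2
  · exact hM k hk
  · obtain ⟨n, rfl⟩ := Nat.exists_eq_add_of_le (show K ≤ k by omega)
    exact (step n).1

lemma qH_summable (y r : ℝ) (h0 : 0 ≤ r) (h1 : r < 1) (m : ℕ) :
    Summable (fun k : ℕ => (k:ℝ)^m * (qH y k * r^k)) := by
  obtain ⟨ρ, hrρ, hρ1⟩ := exists_between h1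
  have hρ0 : 0 < ρ := h0.trans_lt hrρ
  obtain ⟨C, hC⟩ := qH_bound y ρ hρ0 hρ1
  have hs := (summable_pow_mul_geometric_of_norm_lt_one (R := ℝ) m (r := r/ρ)
    (by rw [Real.norm_eq_abs, abs_of_nonneg (by positivity), div_lt_one hρ0]; exact hrρ)).mul_left C
  refine Summable.of_nonneg_of_le (fun k => ?_) (fun k => ?_) hs
  · have := qH_nonneg y k
    positivity
  · have e : (k:ℝ)^m * (qH y k * r^k) = (ρ^k * qH y k) * ((k:ℝ)^m * (r/ρ)^k) := by
      rw [div_pow]; field_simp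
    rw [e]
    exact mul_le_mul_of_nonneg_right (hC k) (by positivity)

lemma qH_summable_shift (y r : ℝ) (h0 : 0 ≤ r) (h1 : r < 1) (m j : ℕ) :
    Summable (fun k : ℕ => ((k + j : ℕ):ℝ)^m * (qH y (k+j) * r^k)) := by
  set R := (r+1)/2 with hR
  have hR0 : 0 < R := by rw [hR]; linarith
  have hR1 : R < 1 := by rw [hR]; linarith
  have hrR : r < R := by rw [hR]; linarith
  have hs := ((summable_nat_add_iff j).2 (qH_summable y R hR0.le hR1 m)).mul_left (R^j)⁻¹
  refine Summable.of_nonneg_of_le (fun k => ?_) (fun k => ?_) hs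
  · have := qH_nonneg y (k+j)
    positivity
  · have hq := qH_nonneg y (k+j)
    have e : (R^j)⁻¹ * (((k + j : ℕ):ℝ)^m * (qH y (k+j) * R^(k+j)))
        = ((k + j : ℕ):ℝ)^m * (qH y (k+j) * R^k) := by
      rw [pow_add]; field_simp
    rw [e]
    gcongr

/-- `h_k h_{k+1} / (2^k k!)`. -/
noncomputable def aH (y : ℝ) (k : ℕ) : ℝ :=
  hermiteH k y * hermiteH (k+1) y / (2^k * (Nat.factorial k))

/-- `h_k h_{k+2} / (2^k k!)`. -/
noncomputable def bH (y : ℝ) (k : ℕ) : ℝ :=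
  hermiteH k y * hermiteH (k+2) y / (2^k * (Nat.factorial k))

lemma aH_zero (y : ℝ) : aH y 0 = 2 * y * qH y 0 := by
  simp [aH, qH, hermiteH_zero, hermiteH_one]

lemma aH_succ (y : ℝ) (k : ℕ) : aH y (k+1) = 2 * y * qH y (k+1) - aH y k := by
  have hf : (0:ℝ) < (Nat.factorial k) := by exact_mod_cast Nat.factorial_pos k
  unfold aH qH
  rw [show k + 1 + 1 = k + 2 from rfl, hermiteH_rec, Nat.factorial_succ]
  push_cast
  field_simp
  ring

lemma bH_eq (y : ℝ) (k : ℕ) : bH y k = 2 * y * aH y k - 2 * (k+1) * qH y k := by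
  unfold aH bH qH
  rw [hermiteH_rec]
  ring

lemma dH_zero (y : ℝ) : qH y 1 = y * aH y 0 := by
  simp [aH, qH, hermiteH_zero, hermiteH_one]
  ring

lemma dH_succ (y : ℝ) (k : ℕ) : ((k:ℝ)+2) * qH y (k+2) = y * aH y (k+1) - 1/2 * bH y k := by
  have hf : (0:ℝ) < (Nat.factorial k) := by exact_mod_cast Nat.factorial_pos k
  unfold aH qH bH
  rw [show k + 1 + 1 = k + 2 from rfl, Nat.factorial_succ (k+1), Nat.factorial_succ k]
  have := hermiteH_rec k y
  push_cast
  field_simp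
  rw [show (2:ℝ)^(k+2) = 4 * 2^k by ring, show (2:ℝ)^(k+1) = 2 * 2^k by ring]
  generalize hermiteH (k+2) y = Z at *
  field_simp
  rw [this]
  ring

lemma aH_summable (y r : ℝ) (h0 : 0 ≤ r) (h1 : r < 1) :
    Summable (fun k : ℕ => aH y k * r^k) := by
  refine Summable.of_norm_bounded ((qH_summable_shift y r h0 h1 0 0).add
    ((qH_summable_shift y r h0 h1 1 1).mul_left 2)) (fun k => ?_)
  have hf : (0:ℝ) < (Nat.factorial k) := by exact_mod_cast Nat.factorial_pos k
  have h2 : |aH y k| ≤ qH y k + 2 * ((k+1) * qH y (k+1)) := by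
    have e : qH y k + 2 * ((k+1) * qH y (k+1)) =
        (hermiteH k y^2 + hermiteH (k+1) y^2) / (2^k * Nat.factorial k) := by
      unfold qH
      rw [Nat.factorial_succ]
      push_cast
      field_simp
      ring
    rw [e]
    unfold aH
    rw [abs_div, abs_of_pos (a := (2:ℝ)^k * Nat.factorial k) (by positivity)]
    gcongr
    rw [abs_le]
    constructor <;> nlinarith [sq_nonneg (hermiteH k y + hermiteH (k+1) y),
      sq_nonneg (hermiteH k y - hermiteH (k+1) y), sq_nonneg (hermiteH k y),
      sq_nonneg (hermiteH (k+1) y)]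
  rw [norm_mul, norm_pow, Real.norm_eq_abs, Real.norm_eq_abs, abs_of_nonneg h0]
  calc |aH y k| * r^k ≤ (qH y k + 2 * ((k+1) * qH y (k+1))) * r^k := by gcongr
    _ = _ := by push_cast; simp only [add_zero]; ring

lemma kq_summable (y r : ℝ) (h0 : 0 ≤ r) (h1 : r < 1) :
    Summable (fun k : ℕ => ((k:ℝ)+1) * qH y k * r^k) := by
  refine ((qH_summable y r h0 h1 1).add (qH_summable y r h0 h1 0)).congr (fun k => ?_)
  ring

lemma bH_summable (y r : ℝ) (h0 : 0 ≤ r) (h1 : r < 1) :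
    Summable (fun k : ℕ => bH y k * r^k) := by
  refine (((aH_summable y r h0 h1).mul_left (2*y)).sub
    ((kq_summable y r h0 h1).mul_left 2)).congr (fun k => ?_)
  rw [bH_eq]; ring

/-- Generating function of the squares. -/
noncomputable def SH (y r : ℝ) : ℝ := ∑' k : ℕ, qH y k * r^k

/-- Its derivative. -/
noncomputable def DH (y r : ℝ) : ℝ := ∑' k : ℕ, ((k:ℝ)+1) * qH y (k+1) * r^k

lemma q_summable (y r : ℝ) (h0 : 0 ≤ r) (h1 : r < 1) :
    Summable (fun k : ℕ => qH y k * r^k) :=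
  (qH_summable y r h0 h1 0).congr (fun k => by simp)

lemma d_summable (y r : ℝ) (h0 : 0 ≤ r) (h1 : r < 1) :
    Summable (fun k : ℕ => ((k:ℝ)+1) * qH y (k+1) * r^k) :=
  (qH_summable_shift y r h0 h1 1 1).congr (fun k => by push_cast; ring)

lemma SH_hasDerivAt (y r : ℝ) (h0 : 0 ≤ r) (h1 : r < 1) :
    HasDerivAt (SH y) (DH y r) r := by
  set R := (r+1)/2 with hR
  have hR0 : 0 < R := by rw [hR]; linarith
  have hR1 : R < 1 := by rw [hR]; linarith
  have hrR : r < R := by rw [hR]; linarith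
  have hu : Summable (fun k : ℕ => (k:ℝ) * qH y k * R^(k-1)) := by
    rw [← summable_nat_add_iff 1]
    refine (d_summable y R hR0.le hR1).congr (fun k => ?_)
    simp
  have key := hasDerivAt_tsum_of_isPreconnected (𝕜 := ℝ) (F := ℝ)
    (g := fun (k:ℕ) (z:ℝ) => qH y k * z^k)
    (g' := fun (k:ℕ) (z:ℝ) => qH y k * (k * z^(k-1))) (t := Set.Ioo (-R) R) (y₀ := 0) (y := r)
    hu isOpen_Ioo isPreconnected_Ioo
    (fun k z _ => (hasDerivAt_pow k z).const_mul _) ?_ ⟨by linarith, hR0⟩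
    (q_summable y 0 le_rfl one_pos) ⟨by linarith, hrR⟩
  · refine key.congr_deriv ?_
    have hs : Summable (fun k : ℕ => qH y k * (k * r^(k-1))) := by
      rw [← summable_nat_add_iff 1]
      refine (d_summable y r h0 h1).congr (fun k => ?_)
      simp; ring
    rw [hs.tsum_eq_zero_add]
    simp only [Nat.cast_zero, zero_mul, mul_zero, zero_add]
    unfold DH
    refine tsum_congr (fun k => ?_)
    simp; ring
  · intro k z hz
    have hq := qH_nonneg y k
    have hz' : |z| ≤ R := (abs_lt.2 hz).le
    rw [norm_mul, norm_mul, norm_pow, Real.norm_eq_abs, Real.norm_eq_abs, Real.norm_eq_abs,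
      abs_of_nonneg hq, abs_of_nonneg (Nat.cast_nonneg k : (0:ℝ) ≤ k)]
    calc qH y k * (k * |z|^(k-1)) ≤ qH y k * (k * R^(k-1)) := by gcongr
      _ = _ := by ring

lemma SH_ode (y r : ℝ) (h0 : 0 ≤ r) (h1 : r < 1) :
    (1 + r)^2 * (1 - r) * DH y r = (2 * y^2 * (1 - r) + r * (1 + r)) * SH y r := by
  set T := ∑' k : ℕ, aH y k * r^k with hT
  set U := ∑' k : ℕ, bH y k * r^k with hU
  have sA := aH_summable y r h0 h1
  have sB := bH_summable y r h0 h1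
  have sQ := q_summable y r h0 h1
  have sD := d_summable y r h0 h1
  have sK := kq_summable y r h0 h1
  have e1 : T = 2 * y * SH y r - r * T := by
    have : ∑' k : ℕ, aH y (k+1) * r^(k+1) =
        2 * y * (∑' k : ℕ, qH y (k+1) * r^(k+1)) - r * T := by
      rw [hT, ← tsum_mul_left, ← tsum_mul_left, ← Summable.tsum_sub]
      · refine tsum_congr (fun k => ?_)
        rw [aH_succ]; ring
      · exact ((summable_nat_add_iff (f := fun k : ℕ => qH y k * r^k) 1).2 sQ).mul_left _
      · exact sA.mul_left _
    have h2 : T = aH y 0 * r^0 + ∑' k : ℕ, aH y (k+1) * r^(k+1) := sA.tsum_eq_zero_add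
    have h3 : SH y r = qH y 0 * r^0 + ∑' k : ℕ, qH y (k+1) * r^(k+1) := sQ.tsum_eq_zero_add
    rw [aH_zero] at h2
    linear_combination h2 + this - 2 * y * h3
  have e2 : ∑' k : ℕ, ((k:ℝ)+1) * qH y k * r^k = SH y r + r * DH y r := by
    have h2 : ∑' k : ℕ, (k:ℝ) * qH y k * r^k = r * DH y r := by
      have s : Summable (fun k : ℕ => (k:ℝ) * qH y k * r^k) :=
        (qH_summable y r h0 h1 1).congr (fun k => by ring)
      rw [s.tsum_eq_zero_add]
      unfold DH
      rw [← tsum_mul_left]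
      simp only [Nat.cast_zero, zero_mul, zero_add]
      refine tsum_congr (fun k => ?_)
      push_cast; ring
    rw [← h2]
    unfold SH
    rw [← Summable.tsum_add sQ ((qH_summable y r h0 h1 1).congr (fun k => by ring))]
    exact tsum_congr (fun k => by ring)
  have e3 : U = 2 * y * T - 2 * (SH y r + r * DH y r) := by
    rw [← e2, hT, hU, ← tsum_mul_left, ← tsum_mul_left, ← Summable.tsum_sub]
    · refine tsum_congr (fun k => ?_)
      rw [bH_eq]; ring
    · exact sA.mul_left _
    · exact sK.mul_left _
  have e4 : DH y r = y * T - 1/2 * r * U := by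
    have : ∑' k : ℕ, (((k+1:ℕ):ℝ)+1) * qH y (k+1+1) * r^(k+1) =
        y * (∑' k : ℕ, aH y (k+1) * r^(k+1)) - 1/2 * r * U := by
      rw [hU, ← tsum_mul_left, ← tsum_mul_left, ← Summable.tsum_sub]
      · refine tsum_congr (fun k => ?_)
        have := dH_succ y k
        rw [show k + 1 + 1 = k + 2 from rfl]
        push_cast
        linear_combination r^(k+1) * this
      · exact ((summable_nat_add_iff (f := fun k : ℕ => aH y k * r^k) 1).2 sA).mul_left _
      · exact sB.mul_left _
    have h2 : T = aH y 0 * r^0 + ∑' k : ℕ, aH y (k+1) * r^(k+1) := sA.tsum_eq_zero_add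
    have h3 : DH y r = _ := sD.tsum_eq_zero_add
    rw [h3, this]
    have := dH_zero y
    simp only [Nat.cast_zero, zero_add, pow_zero]
    linear_combination this - y * h2
  have e5 : (1 + r) * T = 2 * y * SH y r := by linarith
  rw [e3] at e4
  linear_combination (1+r) * e4 + y * (1-r) * e5

lemma SH_sq (y r : ℝ) (h0 : 0 ≤ r) (h1 : r < 1) :
    SH y r ^ 2 * (1 - r^2) = Real.exp (4 * y^2 * r / (1 + r)) := by
  let G : ℝ → ℝ := fun s => (SH y s)^2 * (1 - s^2) * Real.exp (4 * y^2 / (1 + s))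
  have hG : ∀ s, 0 ≤ s → s < 1 → HasDerivAt G 0 s := by
    intro s hs0 hs1
    have hp : (1 + s) ≠ 0 := by positivity
    have d1 := (SH_hasDerivAt y s hs0 hs1).pow 2
    have d2 := ((hasDerivAt_pow 2 s).const_sub 1)
    have d3 := ((hasDerivAt_const s (4*y^2)).div ((hasDerivAt_id s).const_add 1) hp).exp
    refine ((d1.mul d2).mul d3).congr_deriv ?_
    have ode := SH_ode y s hs0 hs1
    simp only [id, Nat.cast_ofNat, Pi.pow_apply, Pi.mul_apply, Pi.div_apply]
    generalize SH y s = S at *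
    generalize DH y s = D at *
    generalize Real.exp _ = E
    field_simp
    linear_combination (2 * E * S * (1 + s)) * ode
  have hc := constant_of_has_deriv_right_zero (f := G) (a := 0) (b := r)
    (fun s hs => (hG s hs.1 (hs.2.trans_lt h1)).continuousAt.continuousWithinAt)
    (fun s hs => (hG s hs.1 (hs.2.trans h1)).hasDerivWithinAt) r ⟨h0, le_rfl⟩
  have hS0 : SH y 0 = 1 := by
    unfold SH
    rw [tsum_eq_single 0]
    · simp [qH, hermiteH_zero]
    · intro k hk; simp [hk]
  simp only [G, hS0] at hc
  have hp : (1 + r) ≠ 0 := by positivity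
  have : Real.exp (4 * y^2 * r / (1 + r)) * Real.exp (4 * y^2 / (1 + r)) = Real.exp (4*y^2) := by
    rw [← Real.exp_add]; congr 1; field_simp; ring
  have hE := Real.exp_pos (4 * y^2 / (1 + r))
  apply mul_right_cancel₀ hE.ne'
  rw [this, hc]
  norm_num

/-! ### Diagonal bound -/

lemma psiH_sq (hb : ℝ) (hpos : 0 < hb) (k : ℕ) (x : ℝ) :
    psiH hb k x * psiH hb k x =
      (Real.sqrt Real.pi * Real.sqrt hb)⁻¹ * Real.exp (-x^2/hb) * qH (x / Real.sqrt hb) k := by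
  have hs : 0 < Real.sqrt hb := Real.sqrt_pos.2 hpos
  have hpi : 0 < Real.sqrt Real.pi := Real.sqrt_pos.2 Real.pi_pos
  have hf : (0:ℝ) < (Nat.factorial k) := by exact_mod_cast Nat.factorial_pos k
  have e : Real.exp (-x^2/hb) = Real.exp (-x^2/(2*hb)) * Real.exp (-x^2/(2*hb)) := by
    rw [← Real.exp_add]; congr 1; field_simp; ring
  have e2 := Real.mul_self_sqrt
    (show 0 ≤ Real.sqrt Real.pi * 2^k * (Nat.factorial k) * Real.sqrt hb by positivity)
  unfold psiH qH
  rw [e]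
  generalize hermiteH k (x / Real.sqrt hb) = H
  generalize Real.exp _ = E
  calc _ = (Real.sqrt (Real.sqrt Real.pi * 2^k * (Nat.factorial k) * Real.sqrt hb) *
      Real.sqrt (Real.sqrt Real.pi * 2^k * (Nat.factorial k) * Real.sqrt hb))⁻¹ * E^2 * H^2 := by
        rw [mul_inv]; ring
    _ = _ := by
        rw [e2]; field_simp

lemma KerK_diag_bound (hb : ℝ) (hpos : 0 < hb) (N : ℕ) (x w : ℝ) (w0 : 0 < w) (w1 : w ≤ 1/2) :
    (KerK hb N x x)^2 * (hb * w) ≤ Real.exp (4 * N * (w + 2 * w^3) - 2 * w * x^2 / hb) := by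
  set y := x / Real.sqrt hb with hy
  have hs : 0 < Real.sqrt hb := Real.sqrt_pos.2 hpos
  have hpi : 0 < Real.sqrt Real.pi := Real.sqrt_pos.2 Real.pi_pos
  have hy2 : y^2 = x^2 / hb := by rw [hy, div_pow, Real.sq_sqrt hpos.le]
  set Q := ∑ k ∈ Finset.range N, qH y k with hQ
  have hQ0 : 0 ≤ Q := Finset.sum_nonneg (fun k _ => qH_nonneg y k)
  have hK : KerK hb N x x = (Real.sqrt Real.pi * Real.sqrt hb)⁻¹ * Real.exp (-x^2/hb) * Q := by
    unfold KerK
    rw [hQ, Finset.mul_sum]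
    exact Finset.sum_congr rfl (fun k _ => psiH_sq hb hpos k x)
  obtain ⟨r, hr⟩ : ∃ r, r = (1 - w)/(1 + w) := ⟨_, rfl⟩
  have hwp : (0:ℝ) < 1 + w := by linarith
  have r0 : 0 < r := by rw [hr]; apply div_pos <;> linarith
  have r1 : r < 1 := by rw [hr, div_lt_one hwp]; linarith
  have hQr : Q * r^N ≤ SH y r := by
    calc Q * r^N ≤ ∑ k ∈ Finset.range N, qH y k * r^k := by
          rw [hQ, Finset.sum_mul]
          refine Finset.sum_le_sum (fun k hk => ?_)
          refine mul_le_mul_of_nonneg_left ?_ (qH_nonneg y k)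
          exact pow_le_pow_of_le_one r0.le r1.le (Finset.mem_range.1 hk).le
      _ ≤ SH y r := (q_summable y r r0.le r1).sum_le_tsum _
          (fun k _ => mul_nonneg (qH_nonneg y k) (by positivity))
  have hS := SH_sq y r r0.le r1
  have h1r : 1 - r^2 = 4 * w / (1+w)^2 := by rw [hr]; field_simp; ring
  have h1r0 : 0 < 1 - r^2 := by rw [h1r]; positivity
  have hQ2 : (Q * r^N)^2 * (1 - r^2) ≤ Real.exp (4 * y^2 * r / (1+r)) := by
    rw [← hS]; gcongr
  set E := Real.exp (2*w + 4*w^3) with hE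
  have hrE : 1 ≤ r * E := by
    have := Real.quadratic_le_exp_of_nonneg (show 0 ≤ 2*w + 4*w^3 by positivity)
    have h2 : 1 + 2*w + 2*w^2 + 4*w^3 ≤ E := by
      refine le_trans ?_ this
      nlinarith [pow_pos w0 3, pow_pos w0 4, pow_pos w0 6]
    rw [hr, div_mul_eq_mul_div, le_div_iff₀ hwp]
    have h3 : (1 - w) * (1 + 2*w + 2*w^2 + 4*w^3) ≤ (1-w) * E :=
      mul_le_mul_of_nonneg_left h2 (by linarith)
    nlinarith [mul_nonneg (pow_pos w0 3).le (sub_nonneg.2 w1)]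
  have hrEN : 1 ≤ (r * E)^(2*N) := one_le_pow₀ hrE
  have hEN : E^(2*N) = Real.exp (4 * N * (w + 2*w^3)) := by
    rw [hE, ← Real.exp_nat_mul]; congr 1; push_cast; ring
  have hwle : w ≤ Real.pi * (1 - r^2) := by
    rw [h1r]
    have : w ≤ 3 * (4 * w / (1+w)^2) := by
      rw [← mul_div_assoc, le_div_iff₀ (by positivity)]
      have h12 : (1+w)^2 ≤ 12 := by nlinarith
      nlinarith [mul_le_mul_of_nonneg_left h12 w0.le]
    refine this.trans ?_
    have := Real.pi_gt_three
    gcongr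
  have hP : ((Real.sqrt Real.pi * Real.sqrt hb)⁻¹)^2 = (Real.pi * hb)⁻¹ := by
    rw [inv_pow, mul_pow, Real.sq_sqrt Real.pi_pos.le, Real.sq_sqrt hpos.le]
  have hX : Real.exp (-x^2/hb) ^ 2 * Real.exp (4 * y^2 * r / (1+r)) =
      Real.exp (- (2 * w * x^2 / hb)) := by
    rw [← Real.exp_nat_mul, ← Real.exp_add, hy2, hr]
    congr 1
    have : 1 + (1-w)/(1+w) ≠ 0 := by rw [← hr]; positivity
    have e : (1-w)/(1+w) / (1 + (1-w)/(1+w)) = (1-w)/2 := by field_simp; ring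
    rw [mul_div_assoc, e]
    push_cast
    field_simp
    ring
  rw [sub_eq_add_neg, Real.exp_add, ← hEN, ← hX, hK, mul_pow, mul_pow, hP]
  have hpp := Real.pi_pos
  calc (Real.pi * hb)⁻¹ * Real.exp (-x^2/hb)^2 * Q^2 * (hb * w)
      ≤ (Real.pi * hb)⁻¹ * Real.exp (-x^2/hb)^2 * Q^2 * (hb * (Real.pi * (1 - r^2))) := by gcongr
    _ = Real.exp (-x^2/hb)^2 * (Q^2 * (1 - r^2)) * 1 := by field_simp
    _ ≤ Real.exp (-x^2/hb)^2 * (Q^2 * (1 - r^2)) * (r * E)^(2*N) := by gcongr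
    _ = E^(2*N) * (Real.exp (-x^2/hb)^2 * ((Q * r^N)^2 * (1 - r^2))) := by
        rw [mul_pow r E, mul_pow Q, ← pow_mul r N 2, mul_comm N 2]; ring
    _ ≤ _ := by gcongr

lemma KerK_sq_le (hb : ℝ) (N : ℕ) (u v : ℝ) :
    (KerK hb N u v)^2 ≤ KerK hb N u u * KerK hb N v v := by
  have := Finset.sum_mul_sq_le_sq_mul_sq (Finset.range N) (fun k => psiH hb k u)
    (fun k => psiH hb k v)
  simpa only [KerK, pow_two] using this

lemma KerK_symm (hb : ℝ) (N : ℕ) (u v : ℝ) : KerK hb N u v = KerK hb N v u := by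
  unfold KerK
  exact Finset.sum_congr rfl (fun k _ => mul_comm _ _)

/-- Diagonal bound in edge scaling: `hb = h³`, `N h³ = b²/2`. -/
lemma edge_diag (b h : ℝ) (hh : 0 < h) (N : ℕ) (hN : N * h^3 = b^2/2) (s w : ℝ)
    (w0 : 0 < w) (w1 : w ≤ 1/2) :
    (h^2 * KerK (h^3) N (b + h^2 * s) (b + h^2 * s))^2 ≤
      h / w * Real.exp (4 * b^2 * (w/h)^3 - 4 * b * s * (w/h) - 2 * w * h * s^2) := by
  have := KerK_diag_bound (h^3) (by positivity) N (b + h^2*s) w w0 w1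
  have hN' : (N:ℝ) = b^2/(2*h^3) := by field_simp; linarith
  have e : 4 * N * (w + 2 * w^3) - 2 * w * (b + h^2*s)^2 / h^3 =
    4 * b^2 * (w/h)^3 - 4 * b * s * (w/h) - 2 * w * h * s^2 := by
    rw [hN']; field_simp; ring
  rw [e] at this
  calc _ = h / w * ((KerK (h^3) N (b + h^2 * s) (b + h^2 * s))^2 * (h^3 * w)) := by
        field_simp
    _ ≤ _ := by gcongr

lemma edge_outer (b h a c : ℝ) (hb : 0 < b) (hh : 0 < h) (ha : 0 < a) (N : ℕ)
    (hN : N * h^3 = b^2/2) (hah : a * h ≤ 1/2) (hab : 2 * b * a^2 ≤ 1)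
    (hc0 : 0 < c) (hc1 : c ≤ 2 * a * b) (hc2 : c ≤ 1/(2*a)) (z : ℝ) (hz : 0 ≤ z) :
    (h^2 * KerK (h^3) N (b + h^2 * z^2) (b + h^2 * z^2))^2 ≤
      1/a * Real.exp (4*b^2*a^3 + c) * Real.exp (-c * z^3) := by
  have hz3 : 0 ≤ z^3 := by positivity
  have hK0 : 0 ≤ 4*b^2*a^3 := by positivity
  rw [mul_assoc, ← Real.exp_add]
  rcases le_total z 1 with h1 | h1
  · refine (edge_diag b h hh N hN (z^2) (a*h) (by positivity) hah).trans ?_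
    have e1 : h / (a*h) = 1/a := by field_simp
    have e2 : a * h / h = a := by field_simp
    rw [e1, e2]
    have hz1 : z^3 ≤ 1 := pow_le_one₀ hz h1
    have p1 : 0 ≤ 4*b*z^2*a := by positivity
    have p2 : 0 ≤ 2*(a*h)*h*(z^2)^2 := by positivity
    gcongr
    nlinarith
  · have hzp : 0 < z := by linarith
    rcases le_total (a*h*z) (1/2) with h2 | h2
    · refine (edge_diag b h hh N hN (z^2) (a*h*z) (by positivity) h2).trans ?_
      have e1 : h / (a*h*z) = 1/(a*z) := by field_simp
      have e2 : a * h * z / h = a*z := by field_simp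
      rw [e1, e2]
      have p2 : 0 ≤ 2*(a*h*z)*h*(z^2)^2 := by positivity
      have p3 : 4*b^2*(a*z)^3 ≤ 2*a*b*z^3 := by
        have := mul_le_mul_of_nonneg_left hab (show 0 ≤ 2*a*b*z^3 by positivity)
        nlinarith
      have p4 : c * z^3 ≤ 2*a*b*z^3 := by gcongr
      gcongr ?_ * Real.exp ?_
      · gcongr; nlinarith
      · nlinarith
    · refine (edge_diag b h hh N hN (z^2) (1/2) (by norm_num) le_rfl).trans ?_
      have e1 : h / (1/2) ≤ 1/a := by
        rw [le_div_iff₀ ha]; linarith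
      have p1 : b ≤ 4 * (z*h)^2 := by
        have : (1:ℝ)/4 ≤ a^2 * (z*h)^2 := by nlinarith
        have h4 : a^2 * b ≤ a^2 * (4 * (z*h)^2) := by nlinarith
        exact le_of_mul_le_mul_left h4 (by positivity)
      have p2 : 4*b^2*(1/2/h)^3 ≤ 4*b*z^2*(1/2/h) := by
        have e : 4*b*z^2*(1/2/h) - 4*b^2*(1/2/h)^3 = b * (4 * (z*h)^2 - b) / (2*h^3) := by
          field_simp; ring
        have : 0 ≤ b * (4 * (z*h)^2 - b) / (2*h^3) := by
          have := sub_nonneg.2 p1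
          positivity
        linarith
      have p3 : c * z^3 ≤ 2*(1/2)*h*(z^2)^2 := by
        have : 1/(2*a) ≤ h*z := by rw [div_le_iff₀ (by positivity)]; nlinarith
        calc c * z^3 ≤ (h*z) * z^3 := by gcongr; exact hc2.trans this
          _ = _ := by ring
      gcongr ?_ * Real.exp ?_
      linarith

lemma edge_inner (b h a : ℝ) (hb : 0 < b) (hh : 0 < h) (ha : 0 < a) (N : ℕ)
    (hN : N * h^3 = b^2/2) (hah : a * h ≤ 1/2) (z : ℝ) (hz : 0 ≤ z) :
    (h^2 * KerK (h^3) N (b - h^2 * z^2) (b - h^2 * z^2))^2 ≤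
      (1/a * (1 + z^3)) * Real.exp (4*b^2*a^3 + 4*a*b) := by
  obtain ⟨Y, hY1, hYz, hY⟩ : ∃ Y : ℝ, 1 ≤ Y ∧ z^2 ≤ Y ∧ Y ≤ 1 + z^3 := by
    rcases le_total z 1 with h1 | h1
    · exact ⟨1, le_rfl, by nlinarith, by have : 0 ≤ z^3 := by positivity
                                         linarith⟩
    · exact ⟨z^2, by nlinarith, le_rfl, by nlinarith [sq_nonneg z]⟩
  have hY0 : 0 < Y := by linarith
  have hw : a*h/Y ≤ 1/2 := by
    refine le_trans ?_ hah
    exact div_le_self (by positivity) hY1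
  have := edge_diag b h hh N hN (-z^2) (a*h/Y) (by positivity) hw
  rw [show b + h^2 * -z^2 = b - h^2*z^2 by ring] at this
  refine this.trans ?_
  have e1 : h / (a*h/Y) = 1/a * Y := by field_simp
  have e2 : a * h / Y / h = a/Y := by field_simp
  rw [e1, e2]
  have p1 : (a/Y)^3 ≤ a^3 := by
    gcongr
    exact div_le_self ha.le hY1
  have p2 : z^2 * (a/Y) ≤ a := by
    rw [← mul_div_assoc, div_le_iff₀ hY0]; nlinarith
  have p3 : 0 ≤ 2*(a*h/Y)*h*(-z^2)^2 := by positivity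
  refine mul_le_mul (by gcongr) (Real.exp_le_exp.2 ?_) (Real.exp_pos _).le (by positivity)
  have q1 := mul_le_mul_of_nonneg_left p1 (show 0 ≤ 4*b^2 by positivity)
  have q2 := mul_le_mul_of_nonneg_left p2 (show 0 ≤ 4*b by positivity)
  nlinarith

lemma edge_combined (b m : ℝ) (hb : 0 < b) (hm : 0 < m) :
    ∃ C > 0, ∃ c > 0, ∀ (h : ℝ) (N : ℕ), 0 < h → h ≤ m → N * h^3 = b^2/2 → ∀ z : ℝ, 0 ≤ z →
      |h^2 * KerK (h^3) N (b - h^2 * z^2) (b + h^2 * z^2)| ≤ C * Real.exp (-c * z^3) := by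
  obtain ⟨a, had⟩ : ∃ a, a = 1/(2 + 2*b + 2*m) := ⟨_, rfl⟩
  have ha : 0 < a := by rw [had]; positivity
  have haeq : a * (2 + 2*b + 2*m) = 1 := by rw [had]; field_simp
  have pab : 0 < a * b := by positivity
  have pam : 0 < a * m := by positivity
  have ham : a * m ≤ 1/2 := by nlinarith
  have hab1 : a * b ≤ 1/2 := by nlinarith
  have ha1 : a ≤ 1/2 := by nlinarith
  have hab : 2*b*a^2 ≤ 1 := by nlinarith
  obtain ⟨c, hc⟩ : ∃ c, c = min (2*a*b) (1/(2*a)) := ⟨_, rfl⟩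
  have hc0 : 0 < c := by rw [hc]; apply lt_min <;> positivity
  have hc1 : c ≤ 2*a*b := by rw [hc]; exact min_le_left _ _
  have hc2 : c ≤ 1/(2*a) := by rw [hc]; exact min_le_right _ _
  obtain ⟨A, hA⟩ : ∃ A, A = (1/a * Real.exp (4*b^2*a^3 + 4*a*b)) *
    (1/a * Real.exp (4*b^2*a^3 + c)) * (1 + 2/c) := ⟨_, rfl⟩
  have hA0 : 0 < A := by rw [hA]; positivity
  refine ⟨1 + A, by positivity, c/8, by positivity, ?_⟩
  intro h N hh hhm hN z hz
  have hah : a * h ≤ 1/2 := le_trans (by gcongr) ham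
  have ho := edge_outer b h a c hb hh ha N hN hah hab hc0 hc1 hc2 z hz
  have hi := edge_inner b h a hb hh ha N hN hah z hz
  have hcs := KerK_sq_le (h^3) N (b - h^2*z^2) (b + h^2*z^2)
  generalize KerK (h^3) N (b - h^2*z^2) (b - h^2*z^2) = Ku at *
  generalize KerK (h^3) N (b + h^2*z^2) (b + h^2*z^2) = Kv at *
  generalize KerK (h^3) N (b - h^2*z^2) (b + h^2*z^2) = K at *
  have hz3 : 0 ≤ z^3 := by positivity
  have hpoly : 1 + z^3 ≤ (1 + 2/c) * Real.exp (c/2 * z^3) := by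
    have := Real.add_one_le_exp (c/2*z^3)
    have h2 : 1 + z^3 ≤ (1 + 2/c) * (c/2*z^3 + 1) := by
      have : (1 + 2/c) * (c/2*z^3 + 1) = 1 + z^3 + (c/2*z^3 + 2/c) := by field_simp; ring
      have p : 0 ≤ c/2*z^3 + 2/c := by positivity
      linarith
    refine h2.trans ?_
    gcongr
  have h4 : |h^2 * K|^4 ≤ ((1 + A) * Real.exp (-(c/8) * z^3))^4 := by
    calc |h^2*K|^4 = (h^4 * K^2)^2 := by
          rw [show |h^2*K|^4 = (|h^2*K|^2)^2 by ring, sq_abs]; ring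
      _ ≤ (h^4 * (Ku * Kv))^2 := by gcongr
      _ = (h^2*Ku)^2 * (h^2*Kv)^2 := by ring
      _ ≤ ((1/a * (1 + z^3)) * Real.exp (4*b^2*a^3 + 4*a*b)) *
          (1/a * Real.exp (4*b^2*a^3 + c) * Real.exp (-c * z^3)) := by gcongr
      _ ≤ ((1/a * ((1 + 2/c) * Real.exp (c/2 * z^3))) * Real.exp (4*b^2*a^3 + 4*a*b)) *
          (1/a * Real.exp (4*b^2*a^3 + c) * Real.exp (-c * z^3)) := by gcongr
      _ = A * (Real.exp (c/2 * z^3) * Real.exp (-c * z^3)) := by rw [hA]; ring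
      _ = A * Real.exp (-(c/8) * z^3)^4 := by
          rw [← Real.exp_add, ← Real.exp_nat_mul]; congr 2; push_cast; ring
      _ ≤ (1+A)^4 * Real.exp (-(c/8) * z^3)^4 := by
          gcongr
          calc A ≤ 1 + A := by linarith
            _ ≤ (1+A)^4 := le_self_pow₀ (by linarith) (by norm_num)
      _ = _ := by ring
  exact le_of_pow_le_pow_left₀ (by norm_num) (by positivity) h4

/-- Uniform superexponential tail bound for the rescaled Christoffel–Darboux kernel
on the antidiagonal at the edge: with `ℏ = μ/N`, there are constants `C, c > 0` with
`|ℏ^{2/3} K_N(√(2μ) - ℏ^{2/3}y, √(2μ) + ℏ^{2/3}y)| ≤ C e^{-c|y|^{3/2}}` for all `N, y`. -/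
theorem edge_kernel_tail_bound (μ : ℝ) (hμ : 0 < μ) :
    ∃ C > 0, ∃ c > 0, ∀ N : ℕ, 1 ≤ N → ∀ y : ℝ,
      |((μ/N) ^ ((2:ℝ)/3)) *
          KerK (μ/N) N (Real.sqrt (2*μ) - ((μ/N) ^ ((2:ℝ)/3)) * y)
            (Real.sqrt (2*μ) + ((μ/N) ^ ((2:ℝ)/3)) * y)|
        ≤ C * Real.exp (-c * |y| ^ ((3:ℝ)/2)) := by
  have hb : 0 < Real.sqrt (2*μ) := Real.sqrt_pos.2 (by positivity)
  have hm : 0 < μ ^ ((1:ℝ)/3) := by positivity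
  obtain ⟨C, hC, c, hc, H⟩ := edge_combined _ _ hb hm
  refine ⟨C, hC, c, hc, ?_⟩
  intro N hN y
  have hNp : (0:ℝ) < N := by exact_mod_cast hN
  have hN1 : (1:ℝ) ≤ N := by exact_mod_cast hN
  have hq : 0 < μ / N := by positivity
  obtain ⟨h, hh⟩ : ∃ h, h = (μ/N) ^ ((1:ℝ)/3) := ⟨_, rfl⟩
  have hh0 : 0 < h := by rw [hh]; positivity
  have h2 : (μ/N) ^ ((2:ℝ)/3) = h^2 := by
    rw [hh, ← Real.rpow_natCast, ← Real.rpow_mul hq.le]; norm_num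
  have h3 : h^3 = μ/N := by
    rw [hh, ← Real.rpow_natCast, ← Real.rpow_mul hq.le]; norm_num
  have hhm : h ≤ μ ^ ((1:ℝ)/3) := by
    rw [hh]
    exact Real.rpow_le_rpow hq.le (div_le_self hμ.le hN1) (by norm_num)
  have hNh : N * h^3 = Real.sqrt (2*μ)^2/2 := by
    rw [h3, Real.sq_sqrt (by positivity)]; field_simp
  have hz := H h N hh0 hhm hNh (Real.sqrt |y|) (Real.sqrt_nonneg _)
  have e3 : Real.sqrt |y| ^ 3 = |y| ^ ((3:ℝ)/2) := by
    rw [Real.sqrt_eq_rpow, ← Real.rpow_natCast, ← Real.rpow_mul (abs_nonneg y)]; norm_num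
  rw [e3, Real.sq_sqrt (abs_nonneg y)] at hz
  rw [h2, ← h3]
  rcases abs_cases y with ⟨e, _⟩ | ⟨e, _⟩
  · rw [e] at hz ⊢
    exact hz
  · rw [KerK_symm]
    rw [e] at hz ⊢
    rw [show Real.sqrt (2*μ) + h^2 * y = Real.sqrt (2*μ) - h^2 * -y by ring,
      show Real.sqrt (2*μ) - h^2 * y = Real.sqrt (2*μ) + h^2 * -y by ring]
    exact hz
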